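/- Let λ ∈ F_{q^n} \ F_q, let t = [F_q(λ):F_q], and let S = ⟨1, λ, …, λ^{k−1}⟩_{F_q} with 1 < k < t. If either (t < n and k ≤ (t+1)/2) or (t = n and k ≤ n/2), then C = Orb(S) is a full weight spectrum code in G_q(n,k) and m(C) = t. -/

import Mathlib

/-!
Setting: `q` is a prime power, realized by a finite field `Fq` with `Fintype.card Fq = q`;
`F` plays the role of `F_{q^n}`: a finite field extension of `Fq` with `Module.finrank Fq F = n`.
`F_q`-subspaces of `F_{q^n}` are `Submodule Fq F`; for a divisor `t` of `n`, the subfield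
`F_{q^t}` is the (unique) `T : IntermediateField Fq F` with `Module.finrank Fq ↥T = t`, and
`F_{q^t}`-subspaces are `Submodule ↥T F`.
-/

set_option synthInstance.maxHeartbeats 1000000

namespace FWS

variable (R : Type*) {F : Type*} [Field R] [Field F] [Algebra R F]

/-- The cyclic shift `α S = {α * s : s ∈ S}` of an `R`-subspace `S` of `F`. -/
def shift (α : F) (S : Submodule R F) : Submodule R F :=
  S.map (LinearMap.mulLeft R α)

/-- The subspace distance `d(U,V) = dim U + dim V - 2 dim (U ⊓ V)`
(which is `2k - 2 dim (U ⊓ V)` for `U, V` of the same dimension `k`). -/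
noncomputable def sdist (U V : Submodule R F) : ℕ :=
  Module.finrank R ↥U + Module.finrank R ↥V - 2 * Module.finrank R ↥(U ⊓ V)

/-- The one-orbit cyclic subspace code `Orb(S) = {α S : α ∈ F*}`. -/
def orb (S : Submodule R F) : Set (Submodule R F) :=
  {T | ∃ α : F, α ≠ 0 ∧ T = shift R α S}

/-- The weight `ω_{2i}(Orb(S)) = #{α S : α ∈ F*, d(S, α S) = 2 i}`. -/
noncomputable def omega (S : Submodule R F) (i : ℕ) : ℕ :=
  Nat.card {T : Submodule R F // T ∈ orb R S ∧ sdist R S T = 2 * i}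

/-- `Orb(S)` is a full weight spectrum (FWS) code: `ω_{2i} > 0` for all `1 ≤ i ≤ dim S`. -/
def IsFWS (S : Submodule R F) : Prop :=
  ∀ i : ℕ, 1 ≤ i → i ≤ Module.finrank R ↥S → 0 < omega R S i

/-- The subspace `⟨1, l, ..., l^(k-1)⟩_R` spanned by the first `k` powers of `l`. -/
def polySpan (l : F) (k : ℕ) : Submodule R F :=
  Submodule.span R ((fun i : ℕ => l ^ i) '' Set.Iio k)

/-- The invariant `m(Orb(S))`: the least divisor `t` of `n` such that
`dim_{F_{q^t}} ⟨S⟩_{F_{q^t}} = 1` (equivalently, the degree of the smallest subfield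
containing a cyclic shift of `S`). -/
noncomputable def mOrb (S : Submodule R F) : ℕ :=
  sInf {t : ℕ | t ∣ Module.finrank R F ∧
    ∃ T : IntermediateField R F, Module.finrank R ↥T = t ∧
      Module.finrank ↥T ↥(Submodule.span ↥T (S : Set F)) = 1}

/-- The stabilizer `H(S) = {x ∈ F* : x S = S} ∪ {0}` of a set `S ⊆ F`, as a subset of `F`
(it is a subfield of `F` when `S` is a subspace). -/
def stab {F : Type*} [Field F] (S : Set F) : Set F :=
  {x : F | x ≠ 0 ∧ (fun y => x * y) '' S = S} ∪ {0}

end FWS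

open FWS

namespace FWS

section

variable {K F : Type*} [Field K] [Field F] [Algebra K F]

theorem finrank_shift {a : F} (ha : a ≠ 0) (S : Submodule K F) :
    Module.finrank K ↥(shift K a S) = Module.finrank K ↥S :=
  (Submodule.equivMapOfInjective (LinearMap.mulLeft K a) (mul_right_injective₀ ha) S).finrank_eq.symm

theorem finrank_polySpan [FiniteDimensional K F] (l : F) {m : ℕ}
    (hm : m ≤ Module.finrank K ↥(IntermediateField.adjoin K {l})) :
    Module.finrank K ↥(polySpan K l m) = m := by
  rw [IntermediateField.adjoin.finrank (Algebra.IsIntegral.isIntegral l)] at hm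
  have hli : LinearIndependent K (fun i : Fin m => l ^ (i : ℕ)) :=
    (linearIndependent_pow (K := K) l).comp (Fin.castLE hm) (Fin.castLE_injective hm)
  have himage : (fun i : ℕ => l ^ i) '' Set.Iio m = Set.range (fun i : Fin m => l ^ (i : ℕ)) := by
    ext x
    simp [Fin.exists_iff]
  rw [polySpan, himage, finrank_span_eq_card hli, Fintype.card_fin]

theorem shift_pow_polySpan (l : F) (k i : ℕ) :
    shift K (l ^ i) (polySpan K l k) =
      Submodule.span K ((fun j : ℕ => l ^ j) '' Set.Ico i (i + k)) := by
  rw [shift, polySpan, Submodule.map_span, Set.image_image]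
  congr 1
  ext x
  constructor
  · rintro ⟨j, hj, rfl⟩
    exact ⟨i + j, ⟨by omega, by simpa using hj⟩, by simp [pow_add]⟩
  · rintro ⟨j, ⟨h₁, h₂⟩, rfl⟩
    exact ⟨j - i, by simp only [Set.mem_Iio]; omega, by simp [← pow_add, Nat.add_sub_cancel' h₁]⟩

theorem polySpan_sup_shift_pow (l : F) {k i : ℕ} (hi : i ≤ k) :
    polySpan K l k ⊔ shift K (l ^ i) (polySpan K l k) = polySpan K l (i + k) := by
  rw [shift_pow_polySpan, polySpan, polySpan, ← Submodule.span_union, ← Set.image_union]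
  congr 2
  ext j
  simp only [Set.mem_union, Set.mem_Iio, Set.mem_Ico]
  omega

theorem sdist_shift_pow_polySpan [FiniteDimensional K F] {l : F} (hl : l ≠ 0) {k i : ℕ}
    (hi : i ≤ k) (hik : i + k ≤ Module.finrank K ↥(IntermediateField.adjoin K {l})) :
    sdist K (polySpan K l k) (shift K (l ^ i) (polySpan K l k)) = 2 * i := by
  have hdim := Submodule.finrank_sup_add_finrank_inf_eq (polySpan K l k)
    (shift K (l ^ i) (polySpan K l k))
  rw [polySpan_sup_shift_pow l hi, finrank_shift (pow_ne_zero i hl), finrank_polySpan l hik,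
    finrank_polySpan l (by omega)] at hdim
  rw [sdist, finrank_shift (pow_ne_zero i hl), finrank_polySpan l (by omega)]
  omega

theorem sdist_shift_of_notMem {T : IntermediateField K F} {S : Submodule K F}
    (hS : ∀ x ∈ S, x ∈ T) {a : F} (ha : a ∉ T) :
    sdist K S (shift K a S) = 2 * Module.finrank K ↥S := by
  have hinf : S ⊓ shift K a S = ⊥ := by
    rw [eq_bot_iff]
    rintro _ ⟨hx, y, hy, rfl⟩
    by_cases hy0 : y = 0
    · simp [hy0]
    · have := T.div_mem (hS _ hx) (hS _ hy)
      simp only [LinearMap.mulLeft_apply, mul_div_cancel_right₀ a hy0] at this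
      exact absurd this ha
  have ha0 : a ≠ 0 := fun h => ha (h ▸ T.zero_mem)
  rw [sdist, hinf, finrank_bot, finrank_shift ha0]
  omega

theorem omega_pos [Finite F] {S : Submodule K F} {i : ℕ} {a : F} (ha : a ≠ 0)
    (h : sdist K S (shift K a S) = 2 * i) : 0 < omega K S i := by
  have : Finite (Submodule K F) := Finite.of_injective _ (SetLike.coe_injective (A := Submodule K F))
  have : Nonempty {T : Submodule K F // T ∈ orb K S ∧ sdist K S T = 2 * i} :=
    ⟨⟨shift K a S, ⟨a, ha, rfl⟩, h⟩⟩
  exact Nat.card_pos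

theorem pow_mem_polySpan (l : F) {k i : ℕ} (hi : i < k) : l ^ i ∈ polySpan K l k :=
  Submodule.subset_span ⟨i, hi, rfl⟩

theorem mem_adjoin_of_mem_polySpan {l : F} {k : ℕ} {x : F} (hx : x ∈ polySpan K l k) :
    x ∈ IntermediateField.adjoin K {l} := by
  have hle : polySpan K l k ≤ Subalgebra.toSubmodule (IntermediateField.adjoin K {l}).toSubalgebra := by
    rw [polySpan, Submodule.span_le]
    rintro _ ⟨i, -, rfl⟩
    exact pow_mem (IntermediateField.mem_adjoin_simple_self K l) i
  exact hle hx

theorem finrank_span_eq_one_iff {T : IntermediateField K F} {S : Set F} (h1 : (1 : F) ∈ S) :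
    Module.finrank ↥T ↥(Submodule.span ↥T S) = 1 ↔ S ⊆ T := by
  constructor
  · intro h x hx
    obtain ⟨c, hc⟩ := (finrank_eq_one_iff_of_nonzero'
      (⟨1, Submodule.subset_span h1⟩ : ↥(Submodule.span ↥T S)) (by simp [Subtype.ext_iff])).1 h
      ⟨x, Submodule.subset_span hx⟩
    have : (c : F) = x := by simpa [Subtype.ext_iff, Algebra.smul_def] using hc
    exact this ▸ c.2
  · intro h
    have : Submodule.span ↥T S = Submodule.span ↥T {(1 : F)} := by
      refine le_antisymm (Submodule.span_le.2 fun x hx => ?_)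
        (Submodule.span_mono (Set.singleton_subset_iff.2 h1))
      exact Submodule.mem_span_singleton.2 ⟨⟨x, h hx⟩, by simp [Algebra.smul_def]⟩
    rw [this, finrank_span_singleton one_ne_zero]

theorem mOrb_polySpan [FiniteDimensional K F] (l : F) {k : ℕ} (hk : 1 < k) :
    mOrb K (polySpan K l k) = Module.finrank K ↥(IntermediateField.adjoin K {l}) := by
  have h1 : (1 : F) ∈ polySpan K l k := by
    simpa using pow_mem_polySpan (K := K) l (i := 0) (by omega)
  refine IsLeast.csInf_eq ⟨⟨?_, _, rfl, ?_⟩, ?_⟩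
  · exact Dvd.intro _ (Module.finrank_mul_finrank K ↥(IntermediateField.adjoin K {l}) F)
  · exact (finrank_span_eq_one_iff h1).2 fun x hx => mem_adjoin_of_mem_polySpan hx
  · rintro _ ⟨-, T, rfl, hT⟩
    have hl : l ∈ T := (finrank_span_eq_one_iff h1).1 hT <| by
      simpa using pow_mem_polySpan (K := K) l hk
    exact IntermediateField.finrank_le_of_le_right (IntermediateField.adjoin_simple_le_iff.2 hl)

end

end FWS

/-- Corollary 4.5: `S = ⟨1, λ, …, λ^(k-1)⟩_{F_q}` with `t = [F_q(λ):F_q]`,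
`1 < k < t`, and either (`t < n` and `k ≤ (t+1)/2`) or (`t = n` and `k ≤ n/2`), generates a
full weight spectrum code with `m(Orb(S)) = t`. -/
theorem polySpan_is_FWS
    {Fq F : Type*} [Field Fq] [Field F] [Algebra Fq F] [Fintype Fq] [Fintype F]
    (q n : ℕ) (hq : Fintype.card Fq = q) (hn : Module.finrank Fq F = n)
    (lam : F) (hlam : lam ∉ Set.range (algebraMap Fq F))
    (t : ℕ) (ht : Module.finrank Fq ↥(IntermediateField.adjoin Fq {lam}) = t)
    (k : ℕ) (hk1 : 1 < k) (hk2 : k < t)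
    (S : Submodule Fq F) (hS : S = polySpan Fq lam k)
    (hcase : (t < n ∧ 2 * k ≤ t + 1) ∨ (t = n ∧ 2 * k ≤ n)) :
    IsFWS Fq S ∧ Module.finrank Fq ↥S = k ∧ mOrb Fq S = t := by
  subst hS
  have hdim : Module.finrank Fq ↥(polySpan Fq lam k) = k := finrank_polySpan lam (by omega)
  refine ⟨fun i hi hik => ?_, hdim, ht ▸ mOrb_polySpan lam hk1⟩
  rw [hdim] at hik
  have hlam0 : lam ≠ 0 := fun h => hlam ⟨0, by simp [h]⟩
  by_cases hit : i + k ≤ t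
  · exact omega_pos (pow_ne_zero i hlam0) (sdist_shift_pow_polySpan hlam0 hik (ht ▸ hit))
  · obtain ⟨htn, rfl⟩ : t < n ∧ i = k := by omega
    obtain ⟨a, ha⟩ : ∃ a : F, a ∉ IntermediateField.adjoin Fq {lam} := by
      by_contra! hall
      have htop : IntermediateField.adjoin Fq {lam} = ⊤ := top_unique fun x _ => hall x
      rw [htop, IntermediateField.finrank_top'] at ht
      omega
    refine omega_pos (a := a) (fun h => ha (h ▸ zero_mem _)) ?_
    rw [sdist_shift_of_notMem (fun x hx => mem_adjoin_of_mem_polySpan hx) ha, hdim]
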